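/- Let ξ_1, ..., ξ_{r-1} be invertible elements of a commutative ring and let ε_n := E_n(ξ_1, ..., ξ_{r-1}, ξ_1^{-1}, ..., ξ_{r-1}^{-1}) (with ε_n = 0 for n < 0). Then for every n ≥ 0, the n-th elementary symmetric polynomial in the 2r+1 variables 1, -1, -1, -ξ_1, ..., -ξ_{r-1}, -ξ_1^{-1}, ..., -ξ_{r-1}^{-1} equals (-1)^n (ε_n + ε_{n-1} - ε_{n-2} - ε_{n-3}). -/

import Mathlib

/-- `E l d`: the `d`-th elementary symmetric polynomial of the list `l`,
with the convention `E l d = 0` for `d < 0` (and automatically `E l d = 0`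
when `d` exceeds the length of `l`, and `E l 0 = 1`). -/
noncomputable def E {R : Type*} [CommRing R] (l : List R) (d : ℤ) : R :=
  if d < 0 then 0 else Multiset.esymm (l : Multiset R) d.toNat

theorem E_cons_aux {R : Type*} [CommRing R] (a : R) (l : List R) (d : ℤ) :
    E (a :: l) d = E l d + a * E l (d - 1) := by
  unfold E
  rcases lt_trichotomy d 0 with h | h | h
  · rw [if_pos h, if_pos h, if_pos (by omega)]; simp
  · subst h
    simp [Multiset.esymm]
  · obtain ⟨k, rfl⟩ : ∃ k : ℕ, d = (k : ℤ) + 1 := ⟨(d - 1).toNat, by omega⟩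
    rw [if_neg (by omega), if_neg (by omega), if_neg (by omega)]
    have h1 : ((k : ℤ) + 1).toNat = k + 1 := by omega
    have h2 : ((k : ℤ) + 1 - 1).toNat = k := by omega
    rw [h1, h2, ← Multiset.cons_coe]
    simp only [Multiset.esymm, Multiset.powersetCard_cons, Multiset.map_add, Multiset.sum_add,
      Multiset.map_map, Function.comp_def, Multiset.prod_cons, Multiset.sum_map_mul_left]

theorem E_neg_aux {R : Type*} [CommRing R] (l : List R) (n : ℕ) :
    E (l.map Neg.neg) n = (-1) ^ n * E l n := by
  unfold E
  rw [if_neg (by omega), if_neg (by omega), ← Multiset.map_coe, Multiset.esymm_neg]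
  simp

theorem esymm_B_series {R : Type*} [CommRing R] (r : ℕ) (hr : 1 ≤ r)
    (ξ : Fin (r - 1) → Rˣ) (n : ℕ) :
    E (1 :: -1 :: -1 ::
        ((List.ofFn fun j => -((ξ j : R))) ++ (List.ofFn fun j => -(((ξ j)⁻¹ : Rˣ) : R))))
        n
      = (-1) ^ n *
        (E ((List.ofFn fun j => ((ξ j : R))) ++ (List.ofFn fun j => (((ξ j)⁻¹ : Rˣ) : R))) n
          + E ((List.ofFn fun j => ((ξ j : R))) ++ (List.ofFn fun j => (((ξ j)⁻¹ : Rˣ) : R))) (n - 1)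
          - E ((List.ofFn fun j => ((ξ j : R))) ++ (List.ofFn fun j => (((ξ j)⁻¹ : Rˣ) : R))) (n - 2)
          - E ((List.ofFn fun j => ((ξ j : R))) ++ (List.ofFn fun j => (((ξ j)⁻¹ : Rˣ) : R))) (n - 3)) := by
  have key : ∀ l : List R, E (1 :: -1 :: -1 :: l.map Neg.neg) n
      = (-1) ^ n * (E l n + E l (n - 1) - E l (n - 2) - E l (n - 3)) := by
    intro l
    have h : (1 :: -1 :: -1 :: l.map Neg.neg) = ((-1 : R) :: 1 :: 1 :: l).map Neg.neg := by simp
    rw [h, E_neg_aux]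
    simp only [E_cons_aux]
    have h2 : (n : ℤ) - 1 - 1 = n - 2 := by ring
    have h3 : (n : ℤ) - 2 - 1 = n - 3 := by ring
    rw [h2, h3]
    ring
  rw [← key]
  simp [List.map_ofFn, Function.comp_def]
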